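/- Let κ be a measurable cardinal, E an extender (in particular, a normal ultrafilter) with critical point κ, and j : V → M the corresponding elementary embedding. Define R_E(α) iff α < κ and j(V_κ) satisfies φ(S, α) ↔ φ(S, κ) for every S ∈ V_α and every first-order formula φ of set theory with two free variables. Then R_E is unbounded in κ and has measure one (with respect to the normal measure on κ derived from E). -/

import Mathlib

/-! ### First-order formulas of set theory (with optional extra unary predicate symbols `P`) -/

/-- First-order formulas in the language of set theory (`∈`, `=`), with variables indexed by `ℕ`
and extra unary predicate symbols drawn from `P`. -/
inductive Fml (P : Type) : Type where
  | mem : ℕ → ℕ → Fml P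
  | eq : ℕ → ℕ → Fml P
  | pr : P → ℕ → Fml P
  | not : Fml P → Fml P
  | and : Fml P → Fml P → Fml P
  | all : ℕ → Fml P → Fml P

namespace Fml

variable {P : Type}

/-- Tarskian satisfaction for `Fml P` in a structure with universe `M`, relativized to the
class `Dom`, with `E` interpreting `∈` and `I` interpreting the extra unary predicates. -/
def Sat {M : Type*} (Dom : M → Prop) (E : M → M → Prop) (I : P → M → Prop) :
    Fml P → (ℕ → M) → Prop
  | .mem i j, v => E (v i) (v j)
  | .eq i j, v => v i = v j
  | .pr p i, v => I p (v i)
  | .not φ, v => ¬ Sat Dom E I φ v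
  | .and φ ψ, v => Sat Dom E I φ v ∧ Sat Dom E I ψ v
  | .all n φ, v => ∀ a, Dom a → Sat Dom E I φ (Function.update v n a)

def imp (φ ψ : Fml P) : Fml P := .not (.and φ (.not ψ))
def orr (φ ψ : Fml P) : Fml P := .not (.and (.not φ) (.not ψ))
def iffF (φ ψ : Fml P) : Fml P := .and (imp φ ψ) (imp ψ φ)
def ex (n : ℕ) (φ : Fml P) : Fml P := .not (.all n (.not φ))
def ball (n w : ℕ) (φ : Fml P) : Fml P := .all n (imp (.mem n w) φ)
def bex (n w : ℕ) (φ : Fml P) : Fml P := ex n (.and (.mem n w) φ)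

/-- Free variables. -/
def free : Fml P → Finset ℕ
  | .mem i j => {i, j}
  | .eq i j => {i, j}
  | .pr _ i => {i}
  | .not φ => free φ
  | .and φ ψ => free φ ∪ free ψ
  | .all n φ => (free φ).erase n

/-- Bound variables. -/
def bnd : Fml P → Finset ℕ
  | .mem _ _ => ∅
  | .eq _ _ => ∅
  | .pr _ _ => ∅
  | .not φ => bnd φ
  | .and φ ψ => bnd φ ∪ bnd ψ
  | .all n φ => insert n (bnd φ)

/-- Substitution of variable `j` for (free occurrences of) variable `i`. -/
def subst (i j : ℕ) : Fml P → Fml P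
  | .mem a b => .mem (if a = i then j else a) (if b = i then j else b)
  | .eq a b => .eq (if a = i then j else a) (if b = i then j else b)
  | .pr p a => .pr p (if a = i then j else a)
  | .not φ => .not (subst i j φ)
  | .and φ ψ => .and (subst i j φ) (subst i j ψ)
  | .all n φ => if n = i then .all n φ else .all n (subst i j φ)

/-- Universal closure. -/
def closure (φ : Fml P) : Fml P := ((free φ).sort (· ≤ ·)).foldr .all φ

/-! #### Auxiliary defined formulas.
Each helper takes an "offset" `o`; its internally bound variables are `o, o+1, …`;
it is used with `o` larger than all argument variables. -/

def subsetF (a b o : ℕ) : Fml P := .all o (imp (.mem o a) (.mem o b))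

def transF (t o : ℕ) : Fml P :=
  .all o (imp (.mem o t) (.all (o+1) (imp (.mem (o+1) o) (.mem (o+1) t))))

/-- `x` is an ordinal (a transitive set of transitive sets; we assume foundation). -/
def isOrdF (x o : ℕ) : Fml P := .and (transF x o) (.all o (imp (.mem o x) (transF o (o+1))))

/-- `x` is a (nonzero) limit ordinal. -/
def isLimF (x o : ℕ) : Fml P :=
  .and (isOrdF x o) (.and (ex o (.mem o x))
    (.all o (imp (.mem o x) (ex (o+1) (.and (.mem (o+1) x) (.mem o (o+1)))))))

/-- `x` is an infinite ordinal (an ordinal that is, or contains, a limit ordinal). -/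
def isInfOrdF (x o : ℕ) : Fml P :=
  .and (isOrdF x o) (orr (isLimF x o) (bex o x (isLimF o (o+1))))

/-- `p` is the Kuratowski pair `⟨u, v⟩`. -/
def kpairF (p u v o : ℕ) : Fml P :=
  .all o (iffF (.mem o p)
    (orr (.all (o+1) (iffF (.mem (o+1) o) (.eq (o+1) u)))
         (.all (o+1) (iffF (.mem (o+1) o) (orr (.eq (o+1) u) (.eq (o+1) v))))))

/-- `f` is a (total) function from `t` to `a` (coded by Kuratowski pairs). -/
def isFuncF (f t a o : ℕ) : Fml P :=
  .and (.and
    (ball o f (bex (o+1) t (bex (o+2) a (kpairF o (o+1) (o+2) (o+3)))))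
    (ball (o+1) t (bex (o+2) a (bex o f (kpairF o (o+1) (o+2) (o+3))))))
    (ball o f (ball (o+5) f (.all (o+1) (.all (o+2) (.all (o+6)
      (imp (.and (kpairF o (o+1) (o+2) (o+3)) (kpairF (o+5) (o+1) (o+6) (o+3)))
        (.eq (o+6) (o+2))))))))

/-- `f` is an injection of `t` into `a`. -/
def injF (f t a o : ℕ) : Fml P :=
  .and (isFuncF f t a o)
    (ball o f (ball (o+5) f (.all (o+1) (.all (o+2) (.all (o+6)
      (imp (.and (kpairF o (o+1) (o+2) (o+3)) (kpairF (o+5) (o+6) (o+2) (o+3)))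
        (.eq (o+6) (o+1))))))))

/-- `t` is strictly less numerous than `a`. -/
def lessNumF (t a o : ℕ) : Fml P :=
  .and (ex o (injF o t a (o+1))) (.not (ex o (injF o a t (o+1))))

/-- `t` is the transitive closure of `x`: the least transitive set including `x`. -/
def isTransClF (x t o : ℕ) : Fml P :=
  .and (.and (subsetF x t o) (transF t o))
    (.all o (imp (.and (subsetF x o (o+1)) (transF o (o+1)))
      (subsetF t o (o+1))))

/-- `k` is a regular ordinal: no function from a smaller ordinal into `k` is cofinal. -/
def isRegF (k o : ℕ) : Fml P :=
  ball o k (.all (o+1) (imp (isFuncF (o+1) o k (o+10))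
    (bex (o+2) k (ball (o+3) (o+1) (.all (o+4) (.all (o+5)
      (imp (kpairF (o+3) (o+4) (o+5) (o+6)) (.mem (o+5) (o+2)))))))))

/-- `k` is a strong limit: for every `b ∈ k` the power set of `b` injects into some `g ∈ k`. -/
def isStrongLimF (k o : ℕ) : Fml P :=
  ball o k (ex (o+1) (.and
    (.all (o+2) (iffF (.mem (o+2) (o+1)) (subsetF (o+2) o (o+3))))
    (bex (o+4) k (ex (o+5) (injF (o+5) (o+1) (o+4) (o+10))))))

/-- `k` is an uncountable ordinal: `ω ∈ k` (least limit ordinal) and `k` does not inject into `ω`. -/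
def isUncountableF (k o : ℕ) : Fml P :=
  bex o k (.and (.and (isLimF o (o+2)) (ball (o+1) o (.not (isLimF (o+1) (o+2)))))
    (.not (ex (o+1) (injF (o+1) k o (o+10)))))

/-- `k` is an inaccessible cardinal: uncountable, regular and a strong limit. -/
def isInaccF (k o : ℕ) : Fml P :=
  .and (.and (isOrdF k o) (isUncountableF k o))
    (.and (isRegF k o) (isStrongLimF k o))

/-- `c` is a closed unbounded subset of `k`. -/
def isClubF (c k o : ℕ) : Fml P :=
  .and (.and (subsetF c k o) (ball o k (bex (o+1) c (.mem o (o+1)))))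
    (ball o k (imp (.and (isLimF o (o+5))
        (ball (o+1) o (bex (o+2) c (.and (.mem (o+1) (o+2)) (.mem (o+2) o)))))
      (.mem o c)))

/-- `k` is a Mahlo cardinal: inaccessible, and every club in `k` contains a regular
(infinite) ordinal. -/
def isMahloF (k o : ℕ) : Fml P :=
  .and (isInaccF k o)
    (.all o (imp (isClubF o k (o+2))
      (bex (o+1) o (.and (isInfOrdF (o+1) (o+10)) (isRegF (o+1) (o+10))))))

/-! #### The axioms of the set theories considered -/

def extAx : Fml P := .all 0 (.all 1 (imp (.all 2 (iffF (.mem 2 0) (.mem 2 1))) (.eq 0 1)))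
def pairAx : Fml P := .all 0 (.all 1 (ex 2 (.all 3 (iffF (.mem 3 2) (orr (.eq 3 0) (.eq 3 1))))))
def unionAx : Fml P := .all 0 (ex 1 (.all 2 (iffF (.mem 2 1) (bex 3 0 (.mem 2 3)))))
def powAx : Fml P := .all 0 (ex 1 (.all 2 (iffF (.mem 2 1) (subsetF 2 0 3))))
def emptyAx : Fml P := ex 0 (.all 1 (.not (.mem 1 0)))
def infAx : Fml P :=
  ex 0 (.and (bex 1 0 (.all 2 (.not (.mem 2 1))))
    (ball 1 0 (bex 2 0 (.all 3 (iffF (.mem 3 2) (orr (.mem 3 1) (.eq 3 1)))))))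
def foundAx : Fml P :=
  .all 0 (imp (ex 1 (.mem 1 0)) (bex 1 0 (.all 2 (imp (.mem 2 1) (.not (.mem 2 0))))))
def choiceAx : Fml P :=
  .all 0 (imp (.and (ball 1 0 (ex 2 (.mem 2 1)))
      (ball 1 0 (ball 2 0 (imp (.not (.eq 1 2)) (.not (ex 3 (.and (.mem 3 1) (.mem 3 2))))))))
    (ex 4 (ball 1 0 (ex 5 (.and (.and (.mem 5 1) (.mem 5 4))
      (.all 6 (imp (.and (.mem 6 1) (.mem 6 4)) (.eq 6 5))))))))
def tcAx : Fml P := .all 0 (ex 1 (isTransClF 0 1 10))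
/-- For every `a` there is the set of all sets whose transitive closure is less numerous
than `a`. -/
def hAx : Fml P :=
  .all 0 (ex 1 (.all 2 (iffF (.mem 2 1) (ex 3 (.and (isTransClF 2 3 10) (lessNumF 3 0 20))))))

/-- An instance of the separation schema for `φ`. -/
def sepInst (φ : Fml P) (z a b : ℕ) : Fml P :=
  closure (.all a (ex b (.all z (iffF (.mem z b) (.and (.mem z a) φ)))))

def sepScheme : Set (Fml P) :=
  {ψ | ∃ (φ : Fml P) (z a b : ℕ), z ≠ a ∧ z ≠ b ∧ a ≠ b ∧ b ∉ free φ ∧ a ∉ free φ ∧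
    ψ = sepInst φ z a b}

/-- An instance of the replacement schema for `φ` (with distinguished variables `x`, `y`). -/
def repInst (φ : Fml P) (x y y' a b : ℕ) : Fml P :=
  closure (.all a (imp
    (ball x a (ex y (.and φ (.all y' (imp (subst y y' φ) (.eq y' y))))))
    (ex b (ball x a (bex y b φ)))))

def repScheme : Set (Fml P) :=
  {ψ | ∃ (φ : Fml P) (x y y' a b : ℕ), [x, y, y', a, b].Nodup ∧
    y' ∉ free φ ∧ y' ∉ bnd φ ∧ a ∉ free φ ∧ b ∉ free φ ∧
    ψ = repInst φ x y y' a b}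

/-- Δ₀ (bounded-quantifier) formulas. -/
inductive IsDelta0 : Fml P → Prop
  | mem (i j : ℕ) : IsDelta0 (.mem i j)
  | eq (i j : ℕ) : IsDelta0 (.eq i j)
  | pr (p : P) (i : ℕ) : IsDelta0 (.pr p i)
  | not {φ} : IsDelta0 φ → IsDelta0 (.not φ)
  | and {φ ψ} : IsDelta0 φ → IsDelta0 ψ → IsDelta0 (.and φ ψ)
  | ball {φ} (z w : ℕ) : z ≠ w → IsDelta0 φ → IsDelta0 (Fml.ball z w φ)

/-- Σ₁ formulas: blocks of existential quantifiers in front of a Δ₀ formula. -/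
inductive IsSigma1 : Fml P → Prop
  | of_delta0 {φ} : IsDelta0 φ → IsSigma1 φ
  | ex {φ} (n : ℕ) : IsSigma1 φ → IsSigma1 (Fml.ex n φ)

def boundedSepScheme : Set (Fml P) :=
  {ψ | ∃ (φ : Fml P) (z a b : ℕ), IsDelta0 φ ∧ z ≠ a ∧ z ≠ b ∧ a ≠ b ∧ b ∉ free φ ∧
    a ∉ free φ ∧ ψ = sepInst φ z a b}

/-- ZFC minus the power set axiom. -/
def zfcMinusPow : Set (Fml P) :=
  {extAx, pairAx, unionAx, emptyAx, infAx, foundAx, choiceAx} ∪ sepScheme ∪ repScheme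

/-- ZFC.  (Separation and replacement are included for all formulas of the language,
so for `P ≠ ∅` this is ZFC with the schemas extended to the enlarged language.) -/
def zfcAx : Set (Fml P) := insert powAx zfcMinusPow

/-- ZFC minus the axiom of infinity. -/
def zfcMinusInf : Set (Fml P) :=
  {extAx, pairAx, unionAx, powAx, emptyAx, foundAx, choiceAx} ∪ sepScheme ∪ repScheme

/-- Rudimentary set theory: extensionality, foundation, empty set, pairing, union,
existence of transitive closures, existence of the set of all sets with transitive closure
less numerous than a given set, and bounded-quantifier separation. -/
def rudimentary : Set (Fml P) :=
  {extAx, foundAx, emptyAx, pairAx, unionAx, tcAx, hAx} ∪ boundedSepScheme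

/-- `(M, E, I)` (with all of `M` as domain) is a model of the theory `T`. -/
def ModelsTh {M : Type*} (E : M → M → Prop) (I : P → M → Prop) (T : Set (Fml P)) : Prop :=
  ∀ φ ∈ T, ∀ v : ℕ → M, Sat (fun _ => True) E I φ v

/-- Consistency of a theory, rendered semantically (equivalent to syntactic consistency by
the Gödel completeness theorem): the theory has a model. -/
def Con (T : Set (Fml P)) : Prop :=
  ∃ (M : Type) (E : M → M → Prop) (I : P → M → Prop), Nonempty M ∧ ModelsTh E I T

end Fml

/-! ### Set-theoretic semantics over the universe `ZFSet` -/

noncomputable section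
open scoped Classical

/-- Satisfaction of first-order formulas over the class `C` of `ZFSet`s, with genuine
membership interpreting `∈` and `I` interpreting the extra predicates. -/
def ZSat {P : Type} (C : ZFSet → Prop) (I : P → ZFSet → Prop) :
    Fml P → (ℕ → ZFSet) → Prop :=
  Fml.Sat C (· ∈ ·) I

/-- The (empty) interpretation of the extra predicates for the pure `∈`-language. -/
def noPred : Empty → ZFSet → Prop := fun p _ => p.elim

/-- `x` is a (von Neumann) ordinal: a transitive set of transitive sets. -/
def IsOrd (x : ZFSet) : Prop := x.IsTransitive ∧ ∀ y ∈ x, ZFSet.IsTransitive y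

/-- Image of a set under an arbitrary (classical) function. -/
def zimage (f : ZFSet → ZFSet) (x : ZFSet) : ZFSet :=
  @ZFSet.image f (Classical.allZFSetDefinable _) x

/-- The cumulative hierarchy: for an ordinal `α`, `Vh α = ⋃_{β ∈ α} 𝒫 (Vh β)` is `V_α`. -/
def Vh : ZFSet → ZFSet :=
  ZFSet.mem_wf.fix fun α ih =>
    ZFSet.sUnion (zimage (fun β => if h : β ∈ α then ZFSet.powerset (ih β h) else ∅) α)

/-- The collection of all subsets of `X` that are definable over `(X, ∈)` with parameters
from `X` (by a first-order formula of set theory). -/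
def DefSet (X : ZFSet) : ZFSet :=
  ZFSet.sep (fun s => ∃ (φ : Fml Empty) (v : ℕ → ZFSet), (∀ n, v n ∈ X) ∧
    ∀ z, z ∈ s ↔ z ∈ X ∧ ZSat (· ∈ X) noPred φ (Function.update v 0 z)) (ZFSet.powerset X)

/-- `LV V α`: level `α` of the constructible hierarchy built above `V`;
`LV V α = V ∪ ⋃_{β ∈ α} DefSet (LV V β)` (so `LV V 0 = V`, `LV V (β+1) = DefSet (LV V β)`
for transitive `V`, with unions at limits). -/
def LV (V : ZFSet) : ZFSet → ZFSet :=
  ZFSet.mem_wf.fix fun α ih =>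
    V ∪ ZFSet.sUnion (zimage (fun β => if h : β ∈ α then DefSet (ih β h) else ∅) α)

/-- Membership in the constructible universe `L`. -/
def LMem (x : ZFSet) : Prop := ∃ α : ZFSet, IsOrd α ∧ x ∈ LV ∅ α

/-- Valuation with `a` at variable `0`, `b` at variable `1`. -/
def v2 (a b : ZFSet) : ℕ → ZFSet := fun n => if n = 0 then a else if n = 1 then b else ∅

/-- Valuation with `a, b, c` at variables `0, 1, 2`. -/
def v3 (a b c : ZFSet) : ℕ → ZFSet :=
  fun n => if n = 0 then a else if n = 1 then b else if n = 2 then c else ∅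

end

/-! ### Elementary embeddings of the universe and the predicate `R_E` -/

/-- `MC` is a transitive class. -/
def IsTransClass (MC : ZFSet.{0} → Prop) : Prop := ∀ x, MC x → ∀ y ∈ x, MC y

/-- `j` is an elementary embedding of the universe `V` of sets into the transitive
class `MC`. -/
def IsElemEmb (j : ZFSet.{0} → ZFSet.{0}) (MC : ZFSet.{0} → Prop) : Prop :=
  IsTransClass MC ∧ (∀ x, MC (j x)) ∧
  ∀ (φ : Fml Empty) (v : ℕ → ZFSet),
    ZSat (fun _ => True) noPred φ v ↔ ZSat MC noPred φ (fun n => j (v n))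

/-- `κ` is the critical point of `j`. -/
def CritPt (j : ZFSet.{0} → ZFSet.{0}) (κ : ZFSet) : Prop :=
  IsOrd κ ∧ (∀ α, α ∈ κ → j α = α) ∧ κ ∈ j κ

/-- The predicate `R_E` derived from the (extender) embedding `j` with critical point `κ`:
`R_E α` iff `α < κ` and `j(V_κ)` satisfies `φ(S, α) ↔ φ(S, κ)` for every `S ∈ V_α` and every
first-order formula `φ` of set theory with two free variables. -/
def RE (j : ZFSet.{0} → ZFSet.{0}) (κ α : ZFSet) : Prop :=
  α ∈ κ ∧ ∀ S : ZFSet, S ∈ Vh α → ∀ φ : Fml Empty,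
    (ZSat (· ∈ j (Vh κ)) noPred φ (v2 S α) ↔ ZSat (· ∈ j (Vh κ)) noPred φ (v2 S κ))

namespace Fml

variable {P : Type}

/-- A strict upper bound for all variables, free or bound, of a formula. -/
def varBound : Fml P → ℕ
  | .mem i j => max (i + 1) (j + 1)
  | .eq i j => max (i + 1) (j + 1)
  | .pr _ i => i + 1
  | .not φ => varBound φ
  | .and φ ψ => max (varBound φ) (varBound ψ)
  | .all n φ => max (n + 1) (varBound φ)

/-- Relativization of a formula to the elements of the variable `w`. -/
def relTo (w : ℕ) : Fml P → Fml P
  | .mem i j => .mem i j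
  | .eq i j => .eq i j
  | .pr p i => .pr p i
  | .not φ => .not (relTo w φ)
  | .and φ ψ => .and (relTo w φ) (relTo w ψ)
  | .all n φ => ball n w (relTo w φ)

/-- The Kuratowski pair `⟨x, y⟩` belongs to `f`. -/
def pairMemF (x y f o : ℕ) : Fml P :=
  ex o (.and (.mem o f) (ex (o + 1) (.and (.mem (o + 1) o) (ex (o + 2) (.and (.mem (o + 2) o)
    (.and (.all (o + 3) (iffF (.mem (o + 3) o) (orr (.eq (o + 3) (o + 1)) (.eq (o + 3) (o + 2)))))
    (.and (.all (o + 3) (iffF (.mem (o + 3) (o + 1)) (.eq (o + 3) x)))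
    (.all (o + 3) (iffF (.mem (o + 3) (o + 2)) (orr (.eq (o + 3) x) (.eq (o + 3) y)))))))))))

section Sat

variable {M : Type*} {D : M → Prop} {E : M → M → Prop} {I : P → M → Prop} {φ ψ : Fml P}
  {v : ℕ → M} {n w : ℕ}

@[simp] theorem sat_mem {i j : ℕ} : Sat D E I (.mem i j) v ↔ E (v i) (v j) := Iff.rfl

@[simp] theorem sat_eq {i j : ℕ} : Sat D E I (.eq i j) v ↔ v i = v j := Iff.rfl

@[simp] theorem sat_not : Sat D E I (.not φ) v ↔ ¬ Sat D E I φ v := Iff.rfl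

@[simp] theorem sat_and : Sat D E I (.and φ ψ) v ↔ Sat D E I φ v ∧ Sat D E I ψ v := Iff.rfl

@[simp] theorem sat_all : Sat D E I (.all n φ) v ↔
    ∀ a, D a → Sat D E I φ (Function.update v n a) := Iff.rfl

@[simp] theorem sat_imp : Sat D E I (imp φ ψ) v ↔ (Sat D E I φ v → Sat D E I ψ v) := by
  simp [imp]

@[simp] theorem sat_orr : Sat D E I (orr φ ψ) v ↔ (Sat D E I φ v ∨ Sat D E I ψ v) := by
  simp only [orr, sat_not, sat_and]; tauto

@[simp] theorem sat_iffF : Sat D E I (iffF φ ψ) v ↔ (Sat D E I φ v ↔ Sat D E I ψ v) := by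
  simp only [iffF, sat_and, sat_imp]; tauto

@[simp] theorem sat_ex : Sat D E I (ex n φ) v ↔
    ∃ a, D a ∧ Sat D E I φ (Function.update v n a) := by
  simp [ex]

@[simp] theorem sat_ball : Sat D E I (ball n w φ) v ↔
    ∀ a, D a → E a (Function.update v n a w) → Sat D E I φ (Function.update v n a) := by
  simp [ball]

theorem sat_relTo {d : M} (hD : ∀ x, E x d → D x) (φ : Fml P) {v v' : ℕ → M}
    (hw : varBound φ ≤ w) (hd : v w = d) (hv : ∀ n < w, v n = v' n) :
    Sat D E I (relTo w φ) v ↔ Sat (E · d) E I φ v' := by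
  induction φ generalizing v v' with
  | mem i j | eq i j =>
    simp only [varBound, sup_le_iff] at hw
    simp [relTo, hv i (by omega), hv j (by omega)]
  | pr p i =>
    simp only [varBound] at hw
    simp [relTo, Sat, hv i (by omega)]
  | not φ ih => simp [relTo, ih hw hd hv]
  | and φ ψ ih₁ ih₂ =>
    simp only [varBound, sup_le_iff] at hw
    simp [relTo, ih₁ hw.1 hd hv, ih₂ hw.2 hd hv]
  | all n φ ih =>
    simp only [varBound, sup_le_iff] at hw
    have hne : w ≠ n := by omega
    simp only [relTo, sat_ball, sat_all, Function.update_of_ne hne, hd]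
    have key : ∀ a, Sat D E I (relTo w φ) (Function.update v n a) ↔
        Sat (E · d) E I φ (Function.update v' n a) := fun a =>
      ih hw.2 (by rw [Function.update_of_ne hne, hd]) fun m hm => by
        by_cases h : m = n
        · simp [h]
        · simp [h, hv m hm]
    exact ⟨fun h a ha => (key a).1 (h a (hD a ha) ha), fun h a _ ha => (key a).2 (h a ha)⟩

end Sat

theorem sat_pairMemF {C : ZFSet → Prop} (hC : ∀ x, C x → ∀ y ∈ x, C y) {I : P → ZFSet → Prop}
    {x y f o : ℕ} {v : ℕ → ZFSet} (hx : x < o) (hy : y < o) (hf : f < o)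
    (hCx : C (v x)) (hCy : C (v y)) (hCf : C (v f)) :
    Sat C (· ∈ ·) I (pairMemF x y f o) v ↔ ZFSet.pair (v x) (v y) ∈ v f := by
  have eq_pair : ∀ a u t, C a → C u → C t →
      ((∀ s, C s → (s ∈ a ↔ s = u ∨ s = t)) ↔ a = {u, t}) := by
    refine fun a u t ha hu ht => ⟨fun h => ?_, by rintro rfl; simp⟩
    ext s
    rw [ZFSet.mem_pair]
    refine ⟨fun hs => (h s (hC a ha s hs)).1 hs, fun hs => (h s ?_).2 hs⟩
    rcases hs with rfl | rfl <;> assumption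
  have eq_single : ∀ a u, C a → C u → ((∀ s, C s → (s ∈ a ↔ s = u)) ↔ a = {u}) := by
    intro a u ha hu
    simpa using eq_pair a u u ha hu hu
  have e1 : x ≠ o := by omega
  have e2 : y ≠ o := by omega
  have e3 : f ≠ o := by omega
  have l1 : ∀ k, x ≠ o + k := by omega
  have l2 : ∀ k, y ≠ o + k := by omega
  simp only [pairMemF, sat_ex, sat_and, sat_mem, sat_all, sat_iffF, sat_eq, sat_orr,
    Function.update_apply, e1, e2, e3, l1, l2, if_true, if_false, left_eq_add, Nat.add_left_cancel_iff,
    OfNat.ofNat_ne_zero, one_ne_zero, Nat.reduceEqDiff, Nat.add_eq_left]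
  constructor
  · rintro ⟨p, hp, hpf, a, ha, hap, b, hb, hbp, h1, h2, h3⟩
    rw [eq_pair _ _ _ hp ha hb] at h1
    rw [eq_single _ _ ha hCx] at h2
    rw [eq_pair _ _ _ hb hCx hCy] at h3
    subst h1 h2 h3
    exact hpf
  · intro h
    have hp := hC _ hCf _ h
    have ha : C {v x} := hC _ hp _ (by simp [ZFSet.pair])
    have hb : C {v x, v y} := hC _ hp _ (by simp [ZFSet.pair])
    refine ⟨_, hp, h, _, ha, by simp [ZFSet.pair], _, hb, by simp [ZFSet.pair], ?_, ?_, ?_⟩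
    · exact (eq_pair _ _ _ hp ha hb).2 rfl
    · exact (eq_single _ _ ha hCx).2 rfl
    · exact (eq_pair _ _ _ hb hCx hCy).2 rfl

/-- An injective coding of pure set-theoretic formulas by natural numbers. -/
def code : Fml Empty → ℕ
  | .mem i j => Nat.pair 0 (Nat.pair i j)
  | .eq i j => Nat.pair 1 (Nat.pair i j)
  | .pr p _ => p.elim
  | .not φ => Nat.pair 2 (code φ)
  | .and φ ψ => Nat.pair 3 (Nat.pair (code φ) (code ψ))
  | .all n φ => Nat.pair 4 (Nat.pair n (code φ))

theorem code_injective : Function.Injective code := by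
  intro φ
  induction φ with
  | pr p _ => exact p.elim
  | mem i j | eq i j =>
    intro ψ h
    cases ψ <;> first | exact Empty.elim ‹_› | simp_all [code, Nat.pair_eq_pair]
  | not φ ih =>
    intro ψ h
    cases ψ with
    | pr p _ => exact p.elim
    | not ψ => rw [ih (by simpa [code, Nat.pair_eq_pair] using h)]
    | _ => simp [code, Nat.pair_eq_pair] at h
  | and φ₁ φ₂ ih₁ ih₂ =>
    intro ψ h
    cases ψ with
    | pr p _ => exact p.elim
    | and ψ₁ ψ₂ =>
      simp only [code, Nat.pair_eq_pair, true_and] at h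
      rw [ih₁ h.1, ih₂ h.2]
    | _ => simp [code, Nat.pair_eq_pair] at h
  | all n φ ih =>
    intro ψ h
    cases ψ with
    | pr p _ => exact p.elim
    | all m ψ =>
      simp only [code, Nat.pair_eq_pair, true_and] at h
      rw [h.1, ih h.2]
    | _ => simp [code, Nat.pair_eq_pair] at h

end Fml

/-- The union of a family of sets indexed by the elements of a set. -/
noncomputable def famUnion (I : ZFSet) (F : ZFSet → ZFSet) : ZFSet :=
  ZFSet.sUnion (zimage F I)

/-- The set of pairs `⟨i, x⟩` with `i ∈ I` and `x ∈ F i`. -/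
noncomputable def famGraph (I : ZFSet) (F : ZFSet → ZFSet) : ZFSet :=
  famUnion I fun i => zimage (ZFSet.pair i) (F i)

theorem mem_zimage {f : ZFSet → ZFSet} {x y : ZFSet} : y ∈ zimage f x ↔ ∃ z ∈ x, f z = y := by
  simp [zimage]

theorem mem_famUnion {I x : ZFSet} {F : ZFSet → ZFSet} :
    x ∈ famUnion I F ↔ ∃ i ∈ I, x ∈ F i := by
  simp [famUnion, mem_zimage]

theorem pair_mem_famGraph {I i x : ZFSet} {F : ZFSet → ZFSet} :
    ZFSet.pair i x ∈ famGraph I F ↔ i ∈ I ∧ x ∈ F i := by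
  simp only [famGraph, mem_famUnion, mem_zimage, ZFSet.pair_inj]
  constructor
  · rintro ⟨_, h, _, h', rfl, rfl⟩
    exact ⟨h, h'⟩
  · rintro ⟨h, h'⟩
    exact ⟨i, h, x, h', rfl, rfl⟩

theorem mem_Vh {α x : ZFSet} : x ∈ Vh α ↔ ∃ β ∈ α, x ⊆ Vh β := by
  rw [Vh, WellFounded.fix_eq, ZFSet.mem_sUnion]
  simp only [mem_zimage]
  constructor
  · rintro ⟨_, ⟨β, hβ, rfl⟩, hx⟩
    rw [dif_pos hβ, ZFSet.mem_powerset] at hx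
    exact ⟨β, hβ, hx⟩
  · rintro ⟨β, hβ, hx⟩
    refine ⟨_, ⟨β, hβ, rfl⟩, ?_⟩
    rw [dif_pos hβ, ZFSet.mem_powerset]
    exact hx

theorem Vh_eq_famUnion (α : ZFSet) : Vh α = famUnion α fun β => (Vh β).powerset := by
  ext x
  simp [mem_Vh, mem_famUnion]

/-- The Zermelo numerals. -/
noncomputable def zermelo : ℕ → ZFSet.{0}
  | 0 => ∅
  | n + 1 => {zermelo n}

theorem zermelo_injective : Function.Injective zermelo := by
  intro m
  induction m with
  | zero =>
    rintro (_ | n) h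
    · rfl
    · exact absurd (h ▸ ZFSet.mem_singleton.2 rfl : zermelo n ∈ zermelo 0) (ZFSet.notMem_empty _)
  | succ m ih =>
    rintro (_ | n) h
    · exact absurd (h ▸ ZFSet.mem_singleton.2 rfl : zermelo m ∈ zermelo 0) (ZFSet.notMem_empty _)
    · rw [ih (ZFSet.singleton_injective h)]

namespace IsElemEmb

variable {j : ZFSet.{0} → ZFSet.{0}} {MC : ZFSet.{0} → Prop}

theorem sat_iff (h : IsElemEmb j MC) (φ : Fml Empty) (v : ℕ → ZFSet) :
    Fml.Sat (fun _ => True) (· ∈ ·) noPred φ v ↔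
      Fml.Sat MC (· ∈ ·) noPred φ (fun n => j (v n)) :=
  h.2.2 φ v

theorem mem_of_mem (h : IsElemEmb j MC) {x y : ZFSet} (hx : x ∈ j y) : MC x :=
  h.1 _ (h.2.1 y) _ hx

theorem mem_iff (h : IsElemEmb j MC) {x y : ZFSet} : j x ∈ j y ↔ x ∈ y :=
  (h.sat_iff (.mem 0 1) (v2 x y)).symm

theorem map_empty (h : IsElemEmb j MC) : j ∅ = ∅ := by
  have := (h.sat_iff (.all 0 (.not (.mem 0 1))) (v2 ∅ ∅)).1 (by simp [v2])
  simp only [Fml.sat_all, Fml.sat_not, Fml.sat_mem, Function.update_apply, v2] at this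
  exact (ZFSet.eq_empty _).2 fun x hx => this x (h.mem_of_mem hx) hx

theorem map_singleton (h : IsElemEmb j MC) (x : ZFSet) : j {x} = {j x} := by
  have := (h.sat_iff (.all 2 (.iffF (.mem 2 1) (.eq 2 0))) (v2 x {x})).1 (by simp [v2])
  simp only [Fml.sat_all, Fml.sat_iffF, Fml.sat_mem, Fml.sat_eq, Function.update_apply, v2] at this
  ext z
  rw [ZFSet.mem_singleton]
  refine ⟨fun hz => (this z (h.mem_of_mem hz)).1 hz, ?_⟩
  rintro rfl
  exact (this _ (h.2.1 x)).2 rfl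

theorem mem_map_powerset (h : IsElemEmb j MC) {x z : ZFSet} :
    z ∈ j x.powerset ↔ MC z ∧ z ⊆ j x := by
  have := (h.sat_iff (.all 2 (.iffF (.mem 2 1) (.ball 3 2 (.mem 3 0)))) (v2 x x.powerset)).1
    (by simp [v2, ZFSet.subset_def])
  simp only [Fml.sat_all, Fml.sat_iffF, Fml.sat_mem, Fml.sat_ball, Function.update_apply, v2]
    at this
  constructor
  · intro hz
    have hM := h.mem_of_mem hz
    exact ⟨hM, fun t ht => (this z hM).1 hz t (h.1 _ hM _ ht) ht⟩
  · rintro ⟨hM, hz⟩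
    exact (this z hM).2 fun t _ ht => hz ht

theorem map_sdiff (h : IsElemEmb j MC) (x y : ZFSet) : j (x \ y) = j x \ j y := by
  have := (h.sat_iff (.all 3 (.iffF (.mem 3 2) (.and (.mem 3 0) (.not (.mem 3 1)))))
    (v3 x y (x \ y))).1 (by simp [v3])
  simp only [Fml.sat_all, Fml.sat_iffF, Fml.sat_mem, Fml.sat_and, Fml.sat_not,
    Function.update_apply, v3] at this
  ext z
  rw [ZFSet.mem_sdiff]
  exact ⟨fun hz => (this z (h.mem_of_mem hz)).1 hz, fun hz => (this z (h.mem_of_mem hz.1)).2 hz⟩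

theorem pair_mem_map_famGraph (h : IsElemEmb j MC) {I i x : ZFSet} {F : ZFSet → ZFSet}
    (hi : i ∈ I) : ZFSet.pair (j i) x ∈ j (famGraph I F) ↔ x ∈ j (F i) := by
  have := (h.sat_iff (.all 3 (.iffF (.pairMemF 0 3 1 4) (.mem 3 2)))
    (v3 i (famGraph I F) (F i))).1 (by
      rw [Fml.sat_all]
      intro a _
      rw [Fml.sat_iffF, Fml.sat_pairMemF (by simp) (by simp) (by simp) (by simp) trivial trivial
        trivial]
      simp [v3, pair_mem_famGraph, hi])
  rw [Fml.sat_all] at this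
  have key : ∀ x, MC x → (ZFSet.pair (j i) x ∈ j (famGraph I F) ↔ x ∈ j (F i)) := by
    intro x hx
    have hx' := this x hx
    rw [Fml.sat_iffF, Fml.sat_pairMemF h.1 (by simp) (by simp) (by simp)
      (by simp [h.2.1]) (by simpa using hx) (by simp [h.2.1])] at hx'
    simpa [v3] using hx'
  refine ⟨fun hx => (key x ?_).1 hx, fun hx => (key x (h.mem_of_mem hx)).2 hx⟩
  exact h.1 _ (h.1 _ (h.mem_of_mem hx) {j i, x} (by simp [ZFSet.pair])) _ (by simp)

theorem mem_map_famUnion (h : IsElemEmb j MC) {I x : ZFSet} {F : ZFSet → ZFSet}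
    (hI : j I = I) (hI' : ∀ i ∈ I, j i = i) : x ∈ j (famUnion I F) ↔ ∃ i ∈ I, x ∈ j (F i) := by
  have := (h.sat_iff (.all 3 (.iffF (.mem 3 2) (.ex 4 (.and (.mem 4 0) (.pairMemF 4 3 1 5)))))
    (v3 I (famGraph I F) (famUnion I F))).1 (by
      simp only [Fml.sat_all, Fml.sat_iffF, Fml.sat_ex, Fml.sat_and]
      intro a _
      simp [Fml.sat_pairMemF, v3, pair_mem_famGraph, mem_famUnion])
  simp only [Fml.sat_all, Fml.sat_iffF, Fml.sat_ex, Fml.sat_and] at this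
  have key : ∀ x, MC x → (x ∈ j (famUnion I F) ↔ ∃ i ∈ I, x ∈ j (F i)) := by
    intro x hx
    have hx' := this x hx
    simp only [Fml.sat_mem, Function.update_apply] at hx'
    refine Iff.trans hx' ⟨?_, ?_⟩
    · rintro ⟨i, hi, hiI, hp⟩
      rw [Fml.sat_pairMemF h.1 (by simp) (by simp) (by simp)
        (by simpa using hi) (by simpa using hx) (by simp [h.2.1])] at hp
      have hiI' : i ∈ I := by simpa [v3, hI] using hiI
      refine ⟨i, hiI', (h.pair_mem_map_famGraph hiI').1 ?_⟩
      simpa [v3, hI' i hiI'] using hp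
    · rintro ⟨i, hi, hxi⟩
      have hMi : MC i := hI' i hi ▸ h.2.1 i
      refine ⟨i, hMi, by simpa [v3, hI] using hi, ?_⟩
      rw [Fml.sat_pairMemF h.1 (by simp) (by simp) (by simp)
        (by simpa using hMi) (by simpa using hx) (by simp [h.2.1])]
      have := (h.pair_mem_map_famGraph hi).2 hxi
      simpa [v3, hI' i hi] using this
  refine ⟨fun hx => (key x (h.mem_of_mem hx)).1 hx, fun hx => (key x ?_).2 hx⟩
  obtain ⟨i, _, hxi⟩ := hx
  exact h.mem_of_mem hxi

theorem map_zermelo (h : IsElemEmb j MC) (n : ℕ) : j (zermelo n) = zermelo n := by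
  induction n with
  | zero => exact h.map_empty
  | succ n ih => rw [zermelo, h.map_singleton, ih]

theorem map_range_zermelo (h : IsElemEmb j MC) :
    j (ZFSet.range zermelo) = ZFSet.range zermelo := by
  have := (h.sat_iff (.ball 1 0 (.orr (.all 2 (.not (.mem 2 1)))
      (.ex 3 (.and (.mem 3 0) (.all 2 (.iffF (.mem 2 1) (.eq 2 3)))))))
    (v2 (ZFSet.range zermelo) ∅)).1 (by
      simp only [Fml.sat_ball, Fml.sat_orr, Fml.sat_all, Fml.sat_not, Fml.sat_mem, Fml.sat_ex,
        Fml.sat_and, Fml.sat_iffF, Fml.sat_eq, Function.update_apply, v2]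
      rintro a - ha
      obtain ⟨_ | n, rfl⟩ := ZFSet.mem_range.1 ha
      · left
        simp [zermelo]
      · right
        exact ⟨zermelo n, trivial, by simp, by simp [zermelo]⟩)
  simp only [Fml.sat_ball, Fml.sat_orr, Fml.sat_all, Fml.sat_not, Fml.sat_mem, Fml.sat_ex,
    Fml.sat_and, Fml.sat_iffF, Fml.sat_eq, Function.update_apply, v2] at this
  ext y
  constructor
  · induction y using ZFSet.inductionOn with
    | _ y ih =>
    intro hy
    have hMy := h.mem_of_mem hy
    rcases this y hMy hy with hy' | ⟨z, hMz, hz, hyz⟩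
    · have : y = ∅ := (ZFSet.eq_empty _).2 fun t ht => hy' t (h.1 _ hMy _ ht) ht
      exact ZFSet.mem_range.2 ⟨0, this.symm⟩
    · have hy' : y = {z} := by
        ext t
        rw [ZFSet.mem_singleton]
        exact ⟨fun ht => (hyz t (h.1 _ hMy _ ht)).1 ht, fun ht => (hyz t (ht ▸ hMz)).2 ht⟩
      obtain ⟨n, hn⟩ := ZFSet.mem_range.1 (ih z (by simp [hy']) hz)
      exact ZFSet.mem_range.2 ⟨n + 1, by rw [zermelo, hn, hy']⟩
  · intro hy
    obtain ⟨n, rfl⟩ := ZFSet.mem_range.1 hy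
    rw [← h.map_zermelo n, h.mem_iff]
    simp

/-- Relativized truth in a set is preserved by an elementary embedding. -/
theorem sat_set_iff (h : IsElemEmb j MC) (φ : Fml Empty) (d x y : ZFSet) :
    ZSat (· ∈ d) noPred φ (v2 x y) ↔ ZSat (· ∈ j d) noPred φ (v2 (j x) (j y)) := by
  obtain ⟨w, hw, hw2⟩ : ∃ w, φ.varBound ≤ w ∧ 2 ≤ w :=
    ⟨max φ.varBound 2, le_max_left _ _, le_max_right _ _⟩
  have := h.sat_iff (φ.relTo w) (Function.update (v2 x y) w d)
  rw [Fml.sat_relTo (d := d) (v' := v2 x y) (by simp) φ hw (by simp)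
      (fun n hn => by simp [hn.ne]),
    Fml.sat_relTo (D := MC) (E := (· ∈ ·)) (d := j d) (v' := v2 (j x) (j y))
      (fun _ (hx : _ ∈ j d) => h.mem_of_mem hx) φ hw
      (by simp) ?_] at this
  · exact this
  · intro n hn
    simp only [Function.update_of_ne hn.ne, v2]
    split_ifs <;> simp [h.map_empty]

variable {κ : ZFSet.{0}}

theorem map_eq_self_of_subset (h : IsElemEmb j MC) {x y : ZFSet} (hy : j y = y)
    (hfix : ∀ z ∈ y, j z = z) (hxy : x ⊆ y) : j x = x := by
  have hsub : j x ⊆ y := by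
    have := h.mem_iff.2 (ZFSet.mem_powerset.2 hxy)
    rw [h.mem_map_powerset, hy] at this
    exact this.2
  ext z
  constructor
  · intro hz
    rwa [← hfix z (hsub hz), h.mem_iff] at hz
  · intro hz
    rwa [← hfix z (hxy hz), h.mem_iff]

theorem map_Vh (h : IsElemEmb j MC) (hκ : CritPt j κ) {α : ZFSet} (hα : α ∈ κ) :
    j (Vh α) = Vh α ∧ ∀ x ∈ Vh α, j x = x := by
  induction α using ZFSet.inductionOn with
  | _ α ih =>
  have trans : ∀ β ∈ α, β ∈ κ := fun β hβ => hκ.1.1 α hα hβ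
  have hfix : ∀ x ∈ Vh α, j x = x := by
    intro x hx
    obtain ⟨β, hβ, hxβ⟩ := mem_Vh.1 hx
    obtain ⟨hV, hfix⟩ := ih β hβ (trans β hβ)
    exact h.map_eq_self_of_subset hV hfix hxβ
  refine ⟨?_, hfix⟩
  ext x
  constructor
  · intro hx
    rw [Vh_eq_famUnion, h.mem_map_famUnion (hκ.2.1 α hα) fun β hβ => hκ.2.1 β (trans β hβ)] at hx
    obtain ⟨β, hβ, hxβ⟩ := hx
    rw [h.mem_map_powerset, (ih β hβ (trans β hβ)).1] at hxβ
    exact mem_Vh.2 ⟨β, hβ, hxβ.2⟩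
  · intro hx
    rwa [← hfix x hx, h.mem_iff]

theorem map_of_mem_Vh (h : IsElemEmb j MC) (hκ : CritPt j κ) {x : ZFSet} (hx : x ∈ Vh κ) :
    j x = x := by
  obtain ⟨β, hβ, hxβ⟩ := mem_Vh.1 hx
  obtain ⟨hV, hfix⟩ := h.map_Vh hκ hβ
  exact h.map_eq_self_of_subset hV hfix hxβ

theorem mem_Vh_of_pair_mem_map (h : IsElemEmb j MC) (hκ : CritPt j κ) {S : ZFSet}
    (hS : ZFSet.pair κ S ∈ j (famGraph κ Vh)) : S ∈ Vh κ := by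
  have := (h.sat_iff (.all 2 (.all 3 (.imp (.pairMemF 2 3 1 6)
      (.ex 4 (.and (.mem 4 2) (.ball 5 3 (.pairMemF 4 5 1 6)))))))
    (v2 κ (famGraph κ Vh))).1 (by
      simp only [Fml.sat_all, Fml.sat_imp, Fml.sat_ex, Fml.sat_and, Fml.sat_ball]
      intro α _ S _ hS
      simp only [Fml.sat_pairMemF, implies_true, Nat.reduceLT, Function.update_apply, v2,
        Fml.sat_mem, OfNat.ofNat_ne_zero, OfNat.ofNat_ne_one, OfNat.one_ne_ofNat, if_true,
        if_false, one_ne_zero, Nat.reduceEqDiff, pair_mem_famGraph] at hS ⊢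
      obtain ⟨hα, hS⟩ := hS
      obtain ⟨β, hβ, hSβ⟩ := mem_Vh.1 hS
      exact ⟨β, trivial, hβ, fun z _ hz => ⟨hκ.1.1 α hα hβ, hSβ hz⟩⟩)
  simp only [Fml.sat_all, Fml.sat_imp, Fml.sat_ex, Fml.sat_and, Fml.sat_ball] at this
  have hMκ : MC κ := h.mem_of_mem hκ.2.2
  have hMS : MC S := h.1 _ (h.1 _ (h.mem_of_mem hS) {κ, S} (by simp [ZFSet.pair])) _ (by simp)
  obtain ⟨β, hMβ, hβ, hz⟩ := this κ hMκ S hMS (by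
    rw [Fml.sat_pairMemF h.1 (by simp) (by simp) (by simp) (by simpa using hMκ)
      (by simpa using hMS) (by simp [h.2.1])]
    simpa [v2] using hS)
  have hβ' : β ∈ κ := by simpa using hβ
  refine mem_Vh.2 ⟨β, hβ', fun z hzS => ?_⟩
  have hMz := h.1 _ hMS _ hzS
  have := hz z hMz (by simpa using hzS)
  rw [Fml.sat_pairMemF h.1 (by simp) (by simp) (by simp) (by simpa using hMβ)
    (by simpa using hMz) (by simp [h.2.1])] at this
  have hp : ZFSet.pair (j β) z ∈ j (famGraph κ Vh) := by
    simpa [v2, hκ.2.1 β hβ'] using this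
  rwa [h.pair_mem_map_famGraph hβ', (h.map_Vh hκ hβ').1] at hp

/-- If `A` consists of the `S ∈ V_κ` for which `φ(S, κ)` holds in `j(V_κ)`, then the set of
`α < κ` such that `φ(·, α)` in `V_κ` agrees with `A` on `V_α` has measure one. -/
theorem crit_mem_map_sep (h : IsElemEmb j MC) (hκ : CritPt j κ) (φ : Fml Empty) {A : ZFSet}
    (hA : ∀ S ∈ Vh κ, (S ∈ A ↔ ZSat (· ∈ j (Vh κ)) noPred φ (v2 S κ))) :
    κ ∈ j (ZFSet.sep (fun α => ∀ S ∈ Vh α,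
      (S ∈ A ↔ ZSat (· ∈ Vh κ) noPred φ (v2 S α))) κ) := by
  set X := ZFSet.sep (fun α => ∀ S ∈ Vh α, (S ∈ A ↔ ZSat (· ∈ Vh κ) noPred φ (v2 S α))) κ with hX
  obtain ⟨w, hw, hw2⟩ : ∃ w, φ.varBound ≤ w ∧ 2 ≤ w :=
    ⟨max φ.varBound 2, le_max_left _ _, le_max_right _ _⟩
  set v : ℕ → ZFSet := fun n =>
    if n = w then Vh κ else if n = w + 1 then κ else if n = w + 2 then X
    else if n = w + 3 then famGraph κ Vh else if n = w + 4 then A else ∅ with hv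
  have v0 : v w = Vh κ := by simp [hv]
  have v1 : v (w + 1) = κ := by simp [hv]
  have v2' : v (w + 2) = X := by simp [hv]
  have v3' : v (w + 3) = famGraph κ Vh := by simp [hv]
  have v4 : v (w + 4) = A := by simp [hv]
  have vlt : ∀ n < w, v n = ∅ := by
    intro n hn
    simp only [hv]
    repeat rw [if_neg (by omega)]
  have ne0 : ∀ k, w + k ≠ 0 := by omega
  have ne1 : ∀ k, w + k ≠ 1 := by omega
  have ne0' : w ≠ 0 := by omega
  have ne1' : w ≠ 1 := by omega
  have := (h.sat_iff (.ball 1 (w + 1) (.iffF (.mem 1 (w + 2))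
      (.all 0 (.imp (.pairMemF 1 0 (w + 3) (w + 5)) (.iffF (.mem 0 (w + 4)) (φ.relTo w)))))) v).1 (by
      simp only [Fml.sat_ball, Fml.sat_imp, Fml.sat_iffF, Fml.sat_all]
      rintro α - hα
      have hα' : α ∈ κ := by simpa [Function.update_of_ne (ne1 _), v1] using hα
      rw [Fml.sat_mem, Function.update_self, Function.update_of_ne (ne1 _), v2', hX,
        ZFSet.mem_sep]
      simp only [hα', true_and, true_imp_iff]
      refine forall_congr' fun S => ?_
      rw [Fml.sat_pairMemF (by simp) (by omega) (by omega) (by omega) trivial trivial trivial,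
        Fml.sat_relTo (d := Vh κ) (v' := v2 S α) (by simp) φ hw (by simp [ne0', ne1', v0])]
      · simp [v3', v4, pair_mem_famGraph, hα', ZSat]
      · intro n hn
        simp only [Function.update_apply, v2]
        split_ifs <;> simp [vlt n hn])
  simp only [Fml.sat_ball, Fml.sat_imp, Fml.sat_iffF, Fml.sat_all] at this
  have hMκ : MC κ := h.mem_of_mem hκ.2.2
  have hκX := this κ hMκ (by simpa [Function.update_of_ne (ne1 _), v1] using hκ.2.2)
  rw [Fml.sat_mem, Function.update_self, Function.update_of_ne (ne1 _), v2'] at hκX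
  refine hκX.2 fun S hMS hS => ?_
  rw [Fml.sat_pairMemF h.1 (by omega) (by omega) (by omega) (by simpa using hMκ)
    (by simpa using hMS) (by simp [h.2.1])] at hS
  have hS' : S ∈ Vh κ := h.mem_Vh_of_pair_mem_map hκ (by
    simpa [Function.update_of_ne (ne1 _), Function.update_of_ne (ne0 _), v3'] using hS)
  rw [Fml.sat_relTo (D := MC) (E := (· ∈ ·)) (d := j (Vh κ)) (v' := v2 S κ)
    (fun _ (hx : _ ∈ j (Vh κ)) => h.mem_of_mem hx) φ hw (by simp [ne0', ne1', v0])]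
  · rw [Fml.sat_mem, Function.update_self, Function.update_of_ne (ne0 _),
      Function.update_of_ne (ne1 _), v4, ← ZSat, ← hA S hS']
    nth_rw 1 [← h.map_of_mem_Vh hκ hS']
    exact h.mem_iff
  · intro n hn
    simp only [Function.update_apply, v2]
    split_ifs <;> simp [vlt n hn, h.map_empty]

end IsElemEmb

/-- Let `κ` be a measurable cardinal, witnessed by an extender `E` with
critical point `κ` via its associated elementary embedding `j : V → M`.  Then `R_E` is
unbounded in `κ`, and (as a subset of `κ`) has measure one with respect to the normal
measure on `κ` derived from `j` (a set `X ⊆ κ` has measure one in that measure precisely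
when `κ ∈ j X`). -/
theorem RE_unbounded_and_measure_one (j : ZFSet.{0} → ZFSet.{0}) (MC : ZFSet.{0} → Prop)
    (κ : ZFSet) (hemb : IsElemEmb j MC) (hcrit : CritPt j κ) :
    (∀ β, β ∈ κ → ∃ α, RE j κ α ∧ β ∈ α) ∧
    κ ∈ j (ZFSet.sep (fun α => RE j κ α) κ) := by
  have truth : ∀ α ∈ κ, ∀ S ∈ Vh α, ∀ φ : Fml Empty,
      (ZSat (· ∈ j (Vh κ)) noPred φ (v2 S α) ↔ ZSat (· ∈ Vh κ) noPred φ (v2 S α)) := by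
    intro α hα S hS φ
    rw [hemb.sat_set_iff φ (Vh κ) S α, (hemb.map_Vh hcrit hα).2 S hS, hcrit.2.1 α hα]
  have Vh_sub : ∀ α ∈ κ, ∀ S ∈ Vh α, S ∈ Vh κ := by
    intro α hα S hS
    obtain ⟨β, hβ, hSβ⟩ := mem_Vh.1 hS
    exact mem_Vh.2 ⟨β, hcrit.1.1 α hα hβ, hSβ⟩
  set X := ZFSet.sep (fun α => RE j κ α) κ with hX
  let Y : Fml Empty → ZFSet := fun φ => ZFSet.sep (fun α => ∀ S ∈ Vh α,
    (ZSat (· ∈ j (Vh κ)) noPred φ (v2 S α) ↔ ZSat (· ∈ j (Vh κ)) noPred φ (v2 S κ))) κ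
  have hY : ∀ φ, κ ∈ j (Y φ) := by
    intro φ
    have := hemb.crit_mem_map_sep hcrit φ
      (A := ZFSet.sep (fun S => ZSat (· ∈ j (Vh κ)) noPred φ (v2 S κ)) (Vh κ))
      (fun S hS => by simp [hS])
    convert this using 2
    ext α
    simp only [Y, ZFSet.mem_sep]
    refine and_congr_right fun hα => forall₂_congr fun S hS => ?_
    rw [truth α hα S hS φ]
    simp only [Vh_sub α hα S hS, true_and]
    exact Iff.comm
  let F : ZFSet → ZFSet := fun i =>
    ZFSet.sep (fun α => ∃ φ : Fml Empty, zermelo φ.code = i ∧ α ∉ Y φ) κ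
  have hF : ∀ φ : Fml Empty, F (zermelo φ.code) = κ \ Y φ := by
    intro φ
    ext α
    simp only [F, ZFSet.mem_sep, ZFSet.mem_sdiff]
    refine and_congr_right fun _ => ⟨?_, fun h => ⟨φ, rfl, h⟩⟩
    rintro ⟨ψ, hψ, h⟩
    rwa [← Fml.code_injective (zermelo_injective hψ)]
  have hdiff : X = κ \ famUnion (ZFSet.range zermelo) F := by
    ext α
    simp only [hX, RE, ZFSet.mem_sep, ZFSet.mem_sdiff, mem_famUnion, and_congr_right_iff]
    intro hα
    simp only [F, Y, ZFSet.mem_sep, hα, true_and]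
    constructor
    · rintro h ⟨_, -, φ, -, hφ⟩
      exact hφ fun S hS => h S hS φ
    · intro h S hS φ
      by_contra hc
      exact h ⟨_, ZFSet.mem_range_self φ.code, φ, rfl, fun h' => hc (h' S hS)⟩
  have hκX : κ ∈ j X := by
    rw [hdiff, hemb.map_sdiff, ZFSet.mem_sdiff, hemb.mem_map_famUnion hemb.map_range_zermelo]
    · refine ⟨hcrit.2.2, ?_⟩
      rintro ⟨i, -, hi⟩
      by_cases hφ : ∃ φ : Fml Empty, zermelo φ.code = i
      · obtain ⟨φ, rfl⟩ := hφ
        rw [hF, hemb.map_sdiff, ZFSet.mem_sdiff] at hi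
        exact hi.2 (hY φ)
      · have : F i = ∅ := (ZFSet.eq_empty _).2 fun α hα => by
          obtain ⟨φ, h, -⟩ := (ZFSet.mem_sep.1 hα).2
          exact hφ ⟨φ, h⟩
        rw [this, hemb.map_empty] at hi
        exact ZFSet.notMem_empty _ hi
    · intro i hi
      obtain ⟨n, rfl⟩ := ZFSet.mem_range.1 hi
      exact hemb.map_zermelo n
  refine ⟨fun β hβ => ?_, hκX⟩
  have := (hemb.sat_iff (.ex 2 (.and (.mem 2 0) (.mem 1 2))) (v2 X β)).2 (by
    simp only [Fml.sat_ex, Fml.sat_and, Fml.sat_mem]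
    exact ⟨κ, hemb.mem_of_mem hκX, by simpa [v2] using hκX,
      by simpa [v2, hcrit.2.1 β hβ] using hβ⟩)
  simp only [Fml.sat_ex, Fml.sat_and, Fml.sat_mem] at this
  obtain ⟨α, -, hα, hβα⟩ := this
  have hα' : α ∈ X := by simpa [v2] using hα
  exact ⟨α, (ZFSet.mem_sep.1 hα').2, by simpa [v2] using hβα⟩
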